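/- Let w_t be the work function at time t ≥ 1 of a 3-server instance on the circle of circumference 2Δ, with last request r = r_t. For every point u of the circle and every triple (x,y,z) ∈ P, there exists a triple (x',y',z') ∈ P such that Φ*(w_t, u, x, y, z) ≥ Φ*(w_t, r, x', y', z'). Consequently, the minimum of Φ*(w_t, u, x, y, z) over all u and all (x,y,z) ∈ P equals the minimum of Φ*(w_t, r_t, x, y, z) over all (x,y,z) ∈ P. -/

import Mathlib

open Finset

/-- Minimum-matching (Wasserstein) distance between two `k`-point configurations,
represented as `k`-tuples of points. -/
noncomputable def confDist {Ω : Type*} [MetricSpace Ω] {k : ℕ} (X Y : Fin k → Ω) : ℝ :=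
  ⨅ σ : Equiv.Perm (Fin k), ∑ i, dist (X i) (Y (σ i))

/-- The work function at time `t` of the `k`-server instance with initial configuration
`X₀` and requests `r 1, r 2, …` (the value `r 0` is unused): the least cost of serving
the first `t` requests and then moving to the configuration `X`. -/
noncomputable def workFn {Ω : Type*} [MetricSpace Ω] (k : ℕ) (X₀ : Fin k → Ω)
    (r : ℕ → Ω) (t : ℕ) (X : Fin k → Ω) : ℝ :=
  sInf { c : ℝ | ∃ Y : ℕ → Fin k → Ω, Y 0 = X₀ ∧
    (∀ i ∈ Finset.Icc 1 t, ∃ j, Y i j = r i) ∧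
    c = (∑ i ∈ Finset.Icc 1 t, confDist (Y (i - 1)) (Y i)) + confDist (Y t) X }

/-- The offline optimum of the `k`-server instance with initial configuration `X₀`
and requests `r 1, …, r T`. -/
noncomputable def opt {Ω : Type*} [MetricSpace Ω] (k : ℕ) (X₀ : Fin k → Ω)
    (r : ℕ → Ω) (T : ℕ) : ℝ :=
  sInf { c : ℝ | ∃ Y : ℕ → Fin k → Ω, Y 0 = X₀ ∧
    (∀ i ∈ Finset.Icc 1 T, ∃ j, Y i j = r i) ∧
    c = ∑ i ∈ Finset.Icc 1 T, confDist (Y (i - 1)) (Y i) }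

/-- `OPT_t(Z)`: the least cost of serving the first `t` requests while ending
in the configuration `Z`. -/
noncomputable def optTo {Ω : Type*} [MetricSpace Ω] (k : ℕ) (X₀ : Fin k → Ω)
    (r : ℕ → Ω) (t : ℕ) (Z : Fin k → Ω) : ℝ :=
  sInf { c : ℝ | ∃ Y : ℕ → Fin k → Ω, Y 0 = X₀ ∧
    (∀ i ∈ Finset.Icc 1 t, ∃ j, Y i j = r i) ∧ Y t = Z ∧
    c = ∑ i ∈ Finset.Icc 1 t, confDist (Y (i - 1)) (Y i) }

/-- `X 0, X 1, …, X T` is a run of the work function algorithm on the `k`-server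
instance with initial configuration `X₀` and requests `r 1, …, r T`. -/
def IsWFARun {Ω : Type*} [MetricSpace Ω] (k : ℕ) (X₀ : Fin k → Ω)
    (r : ℕ → Ω) (T : ℕ) (X : ℕ → Fin k → Ω) : Prop :=
  X 0 = X₀ ∧ ∀ t, 1 ≤ t → t ≤ T →
    (∃ j, X t j = r t) ∧
    ∀ Z : Fin k → Ω, (∃ j, Z j = r t) →
      optTo k X₀ r t (X t) + confDist (X t) (X (t - 1)) ≤
        optTo k X₀ r t Z + confDist Z (X (t - 1))
/-- The antipode `x̄ = x + Δ` of a point on the circle of circumference `2Δ`. -/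
noncomputable def antip (Δ : ℝ) (x : AddCircle (2*Δ)) : AddCircle (2*Δ) := x + (Δ : ℝ)

/-- The set `P`: triples of circle points not contained in any open semicircle,
i.e. with `d(x,y) + d(y,z) + d(z,x) = 2Δ`. -/
def InP (Δ : ℝ) (x y z : AddCircle (2*Δ)) : Prop :=
  dist x y + dist y z + dist z x = 2*Δ

/-- The potential `Φ*(w,u,x,y,z) = w(ū³) + w(u x ȳ) + w(u y z̄) + w(u z x̄)`. -/
noncomputable def PhiStar (Δ : ℝ) (w : (Fin 3 → AddCircle (2*Δ)) → ℝ)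
    (u x y z : AddCircle (2*Δ)) : ℝ :=
  w ![antip Δ u, antip Δ u, antip Δ u] + w ![u, x, antip Δ y]
    + w ![u, y, antip Δ z] + w ![u, z, antip Δ x]

/-- `w(X)` resolves from the `i`-th point of the configuration `X` (w.r.t. the
last request `r`): `w(X) = w(X - X i + r) + d(X i, r)`. -/
def ResolvesFrom {Ω : Type*} [MetricSpace Ω] (w : (Fin 3 → Ω) → ℝ) (r : Ω)
    (X : Fin 3 → Ω) (i : Fin 3) : Prop :=
  w X = w (Function.update X i r) + dist (X i) r

section ConfDist

variable {Ω : Type*} [MetricSpace Ω] {k : ℕ}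

theorem confDist_le_sum (X Y : Fin k → Ω) (σ : Equiv.Perm (Fin k)) :
    confDist X Y ≤ ∑ i, dist (X i) (Y (σ i)) :=
  ciInf_le (Set.finite_range _).bddBelow σ

theorem exists_confDist_eq_sum (X Y : Fin k → Ω) :
    ∃ σ : Equiv.Perm (Fin k), ∑ i, dist (X i) (Y (σ i)) = confDist X Y :=
  exists_eq_ciInf_of_finite

theorem confDist_nonneg (X Y : Fin k → Ω) : 0 ≤ confDist X Y := by
  obtain ⟨σ, hσ⟩ := exists_confDist_eq_sum X Y
  exact hσ ▸ Finset.sum_nonneg fun _ _ => dist_nonneg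

theorem confDist_triangle (X Y Z : Fin k → Ω) :
    confDist X Z ≤ confDist X Y + confDist Y Z := by
  obtain ⟨σ, hσ⟩ := exists_confDist_eq_sum X Y
  obtain ⟨τ, hτ⟩ := exists_confDist_eq_sum Y Z
  calc confDist X Z ≤ ∑ i, dist (X i) (Z ((σ.trans τ) i)) := confDist_le_sum _ _ _
    _ ≤ ∑ i, (dist (X i) (Y (σ i)) + dist (Y (σ i)) (Z (τ (σ i)))) :=
        Finset.sum_le_sum fun i _ => dist_triangle _ _ _
    _ = confDist X Y + confDist Y Z := by
        rw [Finset.sum_add_distrib, hσ, ← hτ,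
          Equiv.sum_comp σ fun i => dist (Y i) (Z (τ i))]

theorem confDist_comp_self_nonpos (X : Fin k → Ω) (σ : Equiv.Perm (Fin k)) :
    confDist (X ∘ σ) X ≤ 0 :=
  (confDist_le_sum _ _ σ).trans (by simp)

theorem confDist_self_comp_nonpos (X : Fin k → Ω) (σ : Equiv.Perm (Fin k)) :
    confDist X (X ∘ σ) ≤ 0 :=
  (confDist_le_sum _ _ σ.symm).trans (by simp)

theorem sum_dist_update_left (X Z : Fin k → Ω) (i : Fin k) (a : Ω) (hZ : Z i = a) :
    ∑ l, dist (Function.update X i a l) (Z l) + dist (X i) a = ∑ l, dist (X l) (Z l) := by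
  rw [← Finset.add_sum_erase _ _ (Finset.mem_univ i),
    ← Finset.add_sum_erase _ (fun l => dist (X l) (Z l)) (Finset.mem_univ i)]
  have : ∑ l ∈ Finset.univ.erase i, dist (Function.update X i a l) (Z l) =
      ∑ l ∈ Finset.univ.erase i, dist (X l) (Z l) :=
    Finset.sum_congr rfl fun l hl => by
      rw [Function.update_of_ne (Finset.ne_of_mem_erase hl)]
  rw [this]
  simp [hZ]

theorem confDist_update_le (X : Fin k → Ω) (i : Fin k) (a : Ω) :
    confDist (Function.update X i a) X ≤ dist (X i) a := by
  refine (confDist_le_sum _ _ 1).trans ?_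
  rw [Finset.sum_eq_single i]
  · simp [dist_comm]
  · intro l _ hl
    simp [Function.update_of_ne hl]
  · simp

theorem exists_confDist_update_add_dist_le (Z X : Fin k → Ω) (j : Fin k) (a : Ω) (hZ : Z j = a) :
    ∃ i, confDist Z (Function.update X i a) + dist (X i) a ≤ confDist Z X := by
  obtain ⟨σ, hσ⟩ := exists_confDist_eq_sum Z X
  refine ⟨σ j, ?_⟩
  have h := sum_dist_update_left (X ∘ σ) Z j a hZ
  have h2 := confDist_le_sum Z (Function.update X (σ j) a) σ
  have h3 : ∀ l, dist (Function.update (X ∘ σ) j a l) (Z l) =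
      dist (Z l) (Function.update X (σ j) a (σ l)) := by
    intro l
    by_cases hl : l = j
    · subst hl; simp [dist_comm]
    · rw [Function.update_of_ne hl, Function.update_of_ne (σ.injective.ne hl), dist_comm,
        Function.comp_apply]
  have h4 : ∑ l, dist (X (σ l)) (Z l) = confDist Z X := by
    rw [← hσ]
    exact Finset.sum_congr rfl fun l _ => dist_comm _ _
  simp only [h3, Function.comp_apply, h4] at h
  linarith

end ConfDist

section WorkFn

variable {Ω : Type*} [MetricSpace Ω] {k : ℕ}

/-- The set of costs whose infimum is the work function. -/
def workCosts (k : ℕ) (X₀ : Fin k → Ω) (r : ℕ → Ω) (t : ℕ) (X : Fin k → Ω) : Set ℝ :=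
  { c : ℝ | ∃ Y : ℕ → Fin k → Ω, Y 0 = X₀ ∧
    (∀ i ∈ Finset.Icc 1 t, ∃ j, Y i j = r i) ∧
    c = (∑ i ∈ Finset.Icc 1 t, confDist (Y (i - 1)) (Y i)) + confDist (Y t) X }

theorem workFn_eq_sInf_workCosts (X₀ : Fin k → Ω) (r : ℕ → Ω) (t : ℕ) (X : Fin k → Ω) :
    workFn k X₀ r t X = sInf (workCosts k X₀ r t X) := rfl

theorem workCosts_nonneg {X₀ : Fin k → Ω} {r : ℕ → Ω} {t : ℕ} {X : Fin k → Ω} {c : ℝ}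
    (hc : c ∈ workCosts k X₀ r t X) : 0 ≤ c := by
  obtain ⟨Y, -, -, rfl⟩ := hc
  exact add_nonneg (Finset.sum_nonneg fun _ _ => confDist_nonneg _ _) (confDist_nonneg _ _)

theorem workFn_le_of_mem {X₀ : Fin k → Ω} {r : ℕ → Ω} {t : ℕ} {X : Fin k → Ω} {c : ℝ}
    (hc : c ∈ workCosts k X₀ r t X) : workFn k X₀ r t X ≤ c :=
  csInf_le ⟨0, fun _ => workCosts_nonneg⟩ hc

theorem workFn_nonneg (X₀ : Fin k → Ω) (r : ℕ → Ω) (t : ℕ) (X : Fin k → Ω) :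
    0 ≤ workFn k X₀ r t X :=
  Real.sInf_nonneg fun _ => workCosts_nonneg

theorem le_workFn [NeZero k] {X₀ : Fin k → Ω} {r : ℕ → Ω} {t : ℕ} {X : Fin k → Ω} {b : ℝ}
    (h : ∀ c ∈ workCosts k X₀ r t X, b ≤ c) : b ≤ workFn k X₀ r t X := by
  refine le_csInf ⟨_, fun i => if i = 0 then X₀ else fun _ => r i, by simp, ?_, rfl⟩ h
  intro i hi
  have : i ≠ 0 := by have := (Finset.mem_Icc.1 hi).1; lia
  exact ⟨0, by simp [this]⟩

theorem workFn_zero (X₀ : Fin k → Ω) (r : ℕ → Ω) (X : Fin k → Ω) :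
    workFn k X₀ r 0 X = confDist X₀ X := by
  have : workCosts k X₀ r 0 X = {confDist X₀ X} := by
    ext c
    constructor
    · rintro ⟨Y, rfl, -, rfl⟩
      simp
    · rintro rfl
      exact ⟨fun _ => X₀, rfl, by simp, by simp⟩
  rw [workFn_eq_sInf_workCosts, this, csInf_singleton]

variable [NeZero k] (X₀ : Fin k → Ω) (r : ℕ → Ω) (t : ℕ)

theorem workFn_le_add_confDist (X Z : Fin k → Ω) :
    workFn k X₀ r t X ≤ workFn k X₀ r t Z + confDist Z X := by
  rw [← sub_le_iff_le_add]
  refine le_workFn ?_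
  rintro _ ⟨Y, h0, hY, rfl⟩
  have h1 := workFn_le_of_mem (X := X) ⟨Y, h0, hY, rfl⟩
  have h2 := confDist_triangle (Y t) Z X
  linarith

theorem workFn_comp_perm (X : Fin k → Ω) (σ : Equiv.Perm (Fin k)) :
    workFn k X₀ r t (X ∘ σ) = workFn k X₀ r t X := by
  have h1 := workFn_le_add_confDist X₀ r t X (X ∘ σ)
  have h2 := workFn_le_add_confDist X₀ r t (X ∘ σ) X
  have h3 := confDist_comp_self_nonpos X σ
  have h4 := confDist_self_comp_nonpos X σ
  linarith

theorem workFn_succ_le (X Z : Fin k → Ω) (hZ : ∃ j, Z j = r (t + 1)) :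
    workFn k X₀ r (t + 1) X ≤ workFn k X₀ r t Z + confDist Z X := by
  rw [← sub_le_iff_le_add]
  refine le_workFn ?_
  rintro _ ⟨Y, h0, hY, rfl⟩
  rw [sub_le_iff_le_add]
  refine workFn_le_of_mem ⟨fun i => if i ≤ t then Y i else Z, by simpa using h0, ?_, ?_⟩
  · intro i hi
    have hi' := Finset.mem_Icc.1 hi
    by_cases hit : i ≤ t
    · simpa [hit] using hY i (Finset.mem_Icc.2 ⟨hi'.1, hit⟩)
    · have : i = t + 1 := by lia
      subst this
      simpa using hZ
  · rw [Finset.sum_Icc_succ_top (by lia)]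
    have : ∀ i ∈ Finset.Icc 1 t, confDist (if i - 1 ≤ t then Y (i - 1) else Z)
        (if i ≤ t then Y i else Z) = confDist (Y (i - 1)) (Y i) := by
      intro i hi
      have hi' := Finset.mem_Icc.1 hi
      rw [if_pos (by lia), if_pos hi'.2]
    rw [Finset.sum_congr rfl this]
    simp

theorem exists_workFn_update_add_dist_le (X : Fin k → Ω) :
    ∃ i, workFn k X₀ r t (Function.update X i (r (t + 1))) + dist (X i) (r (t + 1)) ≤
      workFn k X₀ r (t + 1) X := by
  obtain ⟨i, -, hi⟩ := Finset.exists_min_image Finset.univ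
    (fun i => workFn k X₀ r t (Function.update X i (r (t + 1))) + dist (X i) (r (t + 1)))
    ⟨0, Finset.mem_univ _⟩
  refine ⟨i, le_workFn ?_⟩
  rintro _ ⟨Y, h0, hY, rfl⟩
  obtain ⟨j, hj⟩ := hY (t + 1) (by simp)
  obtain ⟨l, hl⟩ := exists_confDist_update_add_dist_le (Y (t + 1)) X j (r (t + 1)) hj
  refine (hi l (Finset.mem_univ l)).trans ?_
  have h1 : workFn k X₀ r t (Function.update X l (r (t + 1))) ≤
      (∑ i ∈ Finset.Icc 1 t, confDist (Y (i - 1)) (Y i)) +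
        confDist (Y t) (Function.update X l (r (t + 1))) :=
    workFn_le_of_mem ⟨Y, h0, fun i hi => hY i (Finset.mem_Icc.2
      ⟨(Finset.mem_Icc.1 hi).1, by have := (Finset.mem_Icc.1 hi).2; lia⟩), rfl⟩
  have h2 := confDist_triangle (Y t) (Y (t + 1)) (Function.update X l (r (t + 1)))
  rw [Finset.sum_Icc_succ_top (by lia)]
  simp only [Nat.add_sub_cancel]
  linarith

theorem workFn_succ_le_update (X : Fin k → Ω) (i : Fin k) :
    workFn k X₀ r (t + 1) X ≤
      workFn k X₀ r t (Function.update X i (r (t + 1))) + dist (X i) (r (t + 1)) :=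
  (workFn_succ_le X₀ r t X (Function.update X i (r (t + 1))) ⟨i, by simp⟩).trans
    (by linarith [confDist_update_le X i (r (t + 1))])

/-- Quasi-convexity of work functions (Koutsoupias–Papadimitriou). -/
theorem workFn_quasiconvex (X Y : Fin k → Ω) :
    ∃ σ : Equiv.Perm (Fin k), ∀ S : Finset (Fin k),
      workFn k X₀ r t (S.piecewise (Y ∘ σ) X) + workFn k X₀ r t (S.piecewise X (Y ∘ σ)) ≤
        workFn k X₀ r t X + workFn k X₀ r t Y := by
  induction t generalizing X Y with
  | zero =>
    obtain ⟨σ, hσ⟩ := exists_confDist_eq_sum X₀ X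
    obtain ⟨τ, hτ⟩ := exists_confDist_eq_sum X₀ Y
    refine ⟨σ.symm.trans τ, fun S => ?_⟩
    simp only [workFn_zero]
    rw [← hσ, ← hτ, ← Finset.sum_add_distrib]
    refine (add_le_add (confDist_le_sum _ _ σ) (confDist_le_sum _ _ σ)).trans ?_
    rw [← Finset.sum_add_distrib]
    refine Finset.sum_le_sum fun i _ => ?_
    by_cases hi : σ i ∈ S
    · simp [hi, add_comm]
    · simp [hi]
  | succ t ih =>
    obtain ⟨i, hi⟩ := exists_workFn_update_add_dist_le X₀ r t X
    obtain ⟨j, hj⟩ := exists_workFn_update_add_dist_le X₀ r t Y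
    set a := r (t + 1)
    obtain ⟨σ, hσ⟩ := ih (Function.update X i a) (Function.update Y j a)
    set m := σ.symm j with hm
    have hY : Function.update Y j a ∘ σ = Function.update (Y ∘ σ) m a := by
      funext l
      by_cases hl : l = m
      · subst hl; simp [hm]
      · have : σ l ≠ j := fun h => hl (by rw [hm, ← h]; simp)
        simp [hl, this]
    rw [hY] at hσ
    refine ⟨(Equiv.swap i m).trans σ, fun S => ?_⟩
    set Z := Y ∘ σ with hZ
    have hZ' : Y ∘ ((Equiv.swap i m).trans σ) = Z ∘ Equiv.swap i m := rfl
    have hYj : Y j = Z m := by simp [hZ, hm]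
    rw [hZ']
    have h1 := workFn_succ_le_update X₀ r t (S.piecewise (Z ∘ Equiv.swap i m) X) i
    have h2 := workFn_succ_le_update X₀ r t (S.piecewise X (Z ∘ Equiv.swap i m)) i
    have h3 : dist (S.piecewise (Z ∘ Equiv.swap i m) X i) a +
        dist (S.piecewise X (Z ∘ Equiv.swap i m) i) a = dist (X i) a + dist (Y j) a := by
      rw [hYj]
      by_cases h : i ∈ S
      · simp [h, add_comm]
      · simp [h]
    suffices h4 : workFn k X₀ r t (Function.update (S.piecewise (Z ∘ Equiv.swap i m) X) i a) +
        workFn k X₀ r t (Function.update (S.piecewise X (Z ∘ Equiv.swap i m)) i a) ≤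
        workFn k X₀ r t (Function.update X i a) + workFn k X₀ r t (Function.update Y j a) by
      linarith
    by_cases hmS : m ∈ S
    · have e1 : Function.update (S.piecewise (Z ∘ Equiv.swap i m) X) i a =
          (insert i S).piecewise (Function.update Z m a) (Function.update X i a) ∘
            Equiv.swap i m := by
        funext l
        by_cases hli : l = i
        · subst hli; simp [hmS]
        · by_cases hlm : l = m
          · subst hlm
            simp [hli, hmS, Ne.symm hli]
          · by_cases hlS : l ∈ S <;>
              simp [hli, hlm, hlS, Equiv.swap_apply_of_ne_of_ne hli hlm]
      have e2 : Function.update (S.piecewise X (Z ∘ Equiv.swap i m)) i a =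
          (insert i S).piecewise (Function.update X i a) (Function.update Z m a) := by
        funext l
        by_cases hli : l = i
        · subst hli; simp
        · by_cases hlm : l = m
          · subst hlm
            simp [hli, hmS]
          · by_cases hlS : l ∈ S <;>
              simp [hli, hlm, hlS, Equiv.swap_apply_of_ne_of_ne hli hlm]
      rw [e1, e2, workFn_comp_perm]
      exact hσ _
    · have e1 : Function.update (S.piecewise (Z ∘ Equiv.swap i m) X) i a =
          (S.erase i).piecewise (Function.update Z m a) (Function.update X i a) := by
        funext l
        by_cases hli : l = i
        · subst hli; simp
        · by_cases hlm : l = m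
          · subst hlm
            simp [hli, hmS]
          · by_cases hlS : l ∈ S <;>
              simp [hli, hlm, hlS, Equiv.swap_apply_of_ne_of_ne hli hlm]
      have e2 : Function.update (S.piecewise X (Z ∘ Equiv.swap i m)) i a =
          (S.erase i).piecewise (Function.update X i a) (Function.update Z m a) ∘
            Equiv.swap i m := by
        funext l
        by_cases hli : l = i
        · subst hli; simp [hmS]
        · by_cases hlm : l = m
          · subst hlm
            simp [hli, hmS, Ne.symm hli]
          · by_cases hlS : l ∈ S <;>
              simp [hli, hlm, hlS, Equiv.swap_apply_of_ne_of_ne hli hlm]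
      rw [e1, e2, workFn_comp_perm]
      exact hσ _

end WorkFn

section Circle

variable {Δ : ℝ}

local postfix:max "ᵃ" => antip _

theorem antip_antip (x : AddCircle (2 * Δ)) : xᵃᵃ = x := by
  have : ((Δ : ℝ) : AddCircle (2 * Δ)) + (Δ : ℝ) = 0 := by
    rw [← AddCircle.coe_add, ← two_mul, AddCircle.coe_period]
  rw [antip, antip, add_assoc, this, add_zero]

theorem exists_abs_le_coe_eq (hΔ : 0 < Δ) (x : AddCircle (2 * Δ)) :
    ∃ s : ℝ, |s| ≤ Δ ∧ (s : AddCircle (2 * Δ)) = x := by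
  have : Fact (0 < 2 * Δ) := ⟨by linarith⟩
  obtain ⟨s, hs, rfl⟩ : x ∈ (fun s : ℝ => (s : AddCircle (2 * Δ))) '' Set.Ico (-Δ) (-Δ + 2 * Δ) := by
    rw [AddCircle.coe_image_Ico_eq]; trivial
  exact ⟨s, abs_le.2 ⟨hs.1, by linarith [hs.2]⟩, rfl⟩

theorem norm_coe_of_abs_le (hΔ : 0 < Δ) {s : ℝ} (hs : |s| ≤ Δ) :
    ‖(s : AddCircle (2 * Δ))‖ = |s| := by
  rw [AddCircle.norm_coe_eq_abs_iff _ (by linarith), abs_of_pos (by linarith : 0 < 2 * Δ)]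
  linarith

theorem dist_antip_right (hΔ : 0 < Δ) (x y : AddCircle (2 * Δ)) :
    dist x yᵃ = Δ - dist x y := by
  obtain ⟨s, hs, hxy⟩ := exists_abs_le_coe_eq hΔ (x - y)
  have h1 : x - yᵃ = ((s - Δ : ℝ) : AddCircle (2 * Δ)) := by
    rw [AddCircle.coe_sub, hxy, antip]; abel
  have h2 : x - yᵃ = ((s + Δ : ℝ) : AddCircle (2 * Δ)) := by
    rw [h1, show s + Δ = s - Δ + 2 * Δ by ring, AddCircle.coe_add_period]
  rw [dist_eq_norm x y, ← hxy, norm_coe_of_abs_le hΔ hs, dist_eq_norm]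
  have hs' := abs_le.1 hs
  rcases le_total 0 s with h | h
  · have h3 : |s - Δ| = Δ - s := by rw [abs_of_nonpos (by linarith)]; ring
    rw [h1, norm_coe_of_abs_le hΔ (by linarith), h3, abs_of_nonneg h]
  · have h3 : |s + Δ| = Δ + s := by rw [abs_of_nonneg (by linarith)]; ring
    rw [h2, norm_coe_of_abs_le hΔ (by linarith), h3, abs_of_nonpos h]
    ring

theorem dist_antip_left (hΔ : 0 < Δ) (x y : AddCircle (2 * Δ)) :
    dist xᵃ y = Δ - dist x y := by
  rw [dist_comm, dist_antip_right hΔ, dist_comm]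

/-- Two points on the same side of `r` are aligned with `r`. -/
theorem dist_add_dist_eq_or_of_mul_nonneg (hΔ : 0 < Δ) {r x y : AddCircle (2 * Δ)} {s t : ℝ}
    (hs : |s| ≤ Δ) (ht : |t| ≤ Δ) (hx : (s : AddCircle (2 * Δ)) = x - r)
    (hy : (t : AddCircle (2 * Δ)) = y - r) (hst : 0 ≤ s * t) :
    dist r x + dist x y = dist r y ∨ dist r y + dist y x = dist r x := by
  have hxy : x - y = ((s - t : ℝ) : AddCircle (2 * Δ)) := by
    rw [AddCircle.coe_sub, hx, hy]; abel
  have h1 : |s - t| = |(|s| - |t|)| := by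
    rcases le_total 0 s with h | h <;> rcases le_total 0 t with h' | h'
    · rw [abs_of_nonneg h, abs_of_nonneg h']
    · rcases mul_eq_zero.1 (le_antisymm (mul_nonpos_of_nonneg_of_nonpos h h') hst) with h0 | h0 <;>
        simp [h0]
    · rcases mul_eq_zero.1 (le_antisymm (mul_nonpos_of_nonpos_of_nonneg h h') hst) with h0 | h0 <;>
        simp [h0]
    · rw [abs_of_nonpos h, abs_of_nonpos h', abs_sub_comm]
      congr 1
      ring
  have h2 : |s - t| ≤ Δ := by
    rw [h1, abs_le]
    constructor <;> linarith [abs_nonneg s, abs_nonneg t]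
  rw [dist_comm y x, dist_comm r x, dist_comm r y, dist_eq_norm x r, dist_eq_norm y r,
    dist_eq_norm x y, hxy, ← hx, ← hy, norm_coe_of_abs_le hΔ hs, norm_coe_of_abs_le hΔ ht,
    norm_coe_of_abs_le hΔ h2, h1]
  rcases le_total |s| |t| with h | h
  · left; rw [abs_of_nonpos (sub_nonpos.2 h)]; ring
  · right; rw [abs_of_nonneg (sub_nonneg.2 h)]; ring

/-- Among three points, two lie on the same side of `r`. -/
theorem exists_aligned (hΔ : 0 < Δ) (r x y z : AddCircle (2 * Δ)) :
    (dist r x + dist x y = dist r y ∨ dist r y + dist y x = dist r x) ∨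
    (dist r y + dist y z = dist r z ∨ dist r z + dist z y = dist r y) ∨
    (dist r x + dist x z = dist r z ∨ dist r z + dist z x = dist r x) := by
  obtain ⟨a, ha, hxa⟩ := exists_abs_le_coe_eq hΔ (x - r)
  obtain ⟨b, hb, hyb⟩ := exists_abs_le_coe_eq hΔ (y - r)
  obtain ⟨c, hc, hzc⟩ := exists_abs_le_coe_eq hΔ (z - r)
  have hsign : 0 ≤ a * b ∨ 0 ≤ b * c ∨ 0 ≤ a * c := by
    rcases le_total 0 a with h1 | h1 <;> rcases le_total 0 b with h2 | h2 <;>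
      rcases le_total 0 c with h3 | h3 <;>
      simp [mul_nonneg_of_nonpos_of_nonpos, mul_nonneg, h1, h2, h3]
  rcases hsign with h | h | h
  · exact .inl (dist_add_dist_eq_or_of_mul_nonneg hΔ ha hb hxa hyb h)
  · exact .inr (.inl (dist_add_dist_eq_or_of_mul_nonneg hΔ hb hc hyb hzc h))
  · exact .inr (.inr (dist_add_dist_eq_or_of_mul_nonneg hΔ ha hc hxa hzc h))

/-- If `r` lies on the arc from `x` to `y`, then so does `u`, unless a shortest path from
`r` to `u` leaves that arc. -/
theorem mem_arc_or_leaves (hΔ : 0 < Δ) {r x y : AddCircle (2 * Δ)} (u : AddCircle (2 * Δ))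
    (h : dist x r + dist r y = dist x y) :
    dist x u + dist u y = dist x y ∨ dist r x + dist x u = dist r u ∨
      dist r y + dist y u = dist r u := by
  have hxr := dist_comm x r
  have hxu := dist_comm x u
  have hyu := dist_comm y u
  have hyx := dist_comm x y
  have t1 := dist_triangle x u y
  have t2 := dist_triangle x r u
  have t3 := dist_triangle u r y
  have t4 := dist_triangle r x u
  have t5 := dist_triangle r y u
  have hur := dist_comm u r
  have n1 := dist_nonneg (x := r) (y := x)
  have n2 := dist_nonneg (x := r) (y := y)
  rcases exists_aligned hΔ r x y u with (h | h) | (h | h) | (h | h)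
  · exact .inr (.inl (by linarith))
  · exact .inr (.inr (by linarith))
  · exact .inr (.inr (by linarith))
  · exact .inl (by linarith)
  · exact .inr (.inl (by linarith))
  · exact .inl (by linarith)

/-- The properties of a work function of three arguments, with last request `r`, that the
potential argument relies on: symmetry, Lipschitz continuity, resolution from one of the
points of a configuration, and exchange of servers between configurations containing `r`. -/
structure IsWorkLike {Ω : Type*} [MetricSpace Ω] (r : Ω) (f : Ω → Ω → Ω → ℝ) : Prop where
  swap_left : ∀ a b c, f a b c = f b a c
  swap_right : ∀ a b c, f a b c = f a c b
  lipschitz : ∀ a a' b c, f a b c ≤ f a' b c + dist a a'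
  resolve : ∀ a b c, f r b c + dist a r ≤ f a b c ∨ f r a c + dist b r ≤ f a b c ∨
    f r a b + dist c r ≤ f a b c
  exchange : ∀ a b c d, f r a c + f r b d ≤ f r a b + f r c d ∨
    f r a d + f r b c ≤ f r a b + f r c d

namespace IsWorkLike

variable {Ω : Type*} [MetricSpace Ω] {r : Ω} {f : Ω → Ω → Ω → ℝ}

theorem comm (h : IsWorkLike r f) (a b : Ω) : f r a b = f r b a := h.swap_right r a b

theorem le_add_dist (h : IsWorkLike r f) (a a' b : Ω) : f r a b ≤ f r a' b + dist a a' := by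
  rw [h.swap_left r a b, h.swap_left r a' b]
  exact h.lipschitz a a' r b

theorem le_add_dist_third (h : IsWorkLike r f) (a b c c' : Ω) :
    f a b c ≤ f a b c' + dist c c' := by
  rw [h.swap_right a b c, h.swap_right a b c', h.swap_left a c b, h.swap_left a c' b]
  exact h.lipschitz c c' a b

theorem quad (h : IsWorkLike r f) (a b c : Ω) :
    f r a b + f r a c ≤ f r a a + f r b c := by
  rcases h.exchange a a b c with h' | h' <;> linarith

theorem le_triple (h : IsWorkLike r f) (a : Ω) : f r a a + dist a r ≤ f a a a := by
  rcases h.resolve a a a with h' | h' | h' <;> exact h'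

theorem triple_le (h : IsWorkLike r f) (a b c p : Ω) :
    f p p p ≤ f a b c + dist p a + dist p b + dist p c := by
  have h1 := h.lipschitz p a p p
  have h2 := h.lipschitz p b a p
  have h3 := h.le_add_dist_third a b p c
  rw [h.swap_left a p p] at h1
  rw [h.swap_left b a p] at h2
  linarith

end IsWorkLike

/-- The value `v` dominates some value of the potential anchored at `r`. -/
def DominatesAt (Δ : ℝ) (r : AddCircle (2 * Δ))
    (f : AddCircle (2 * Δ) → AddCircle (2 * Δ) → AddCircle (2 * Δ) → ℝ) (v : ℝ) : Prop :=
  ∃ x y z, InP Δ x y z ∧ f rᵃ rᵃ rᵃ + f r x yᵃ + f r y zᵃ + f r z xᵃ ≤ v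

variable {r u x y z : AddCircle (2 * Δ)}
  {f : AddCircle (2 * Δ) → AddCircle (2 * Δ) → AddCircle (2 * Δ) → ℝ} {v : ℝ}

theorem inP_antip (hΔ : 0 < Δ) (u y : AddCircle (2 * Δ)) : InP Δ u y uᵃ := by
  simp only [InP, dist_antip_right hΔ, dist_antip_left hΔ, dist_self, dist_comm y u]
  ring

theorem DominatesAt.of_pairs (hΔ : 0 < Δ) (h : IsWorkLike r f) (u y : AddCircle (2 * Δ))
    (hv : f rᵃ rᵃ rᵃ + f r u yᵃ + f r u y + f r uᵃ uᵃ ≤ v) : DominatesAt Δ r f v := by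
  refine ⟨u, y, uᵃ, inP_antip hΔ u y, ?_⟩
  rw [antip_antip, h.comm y u]
  exact hv

theorem DominatesAt.of_inP_request (hΔ : 0 < Δ) (h : IsWorkLike r f) (hP : InP Δ r y z)
    (hv : f r uᵃ uᵃ + Δ - dist u r + f r u yᵃ + f u y zᵃ + f u z rᵃ ≤ v) :
    DominatesAt Δ r f v := by
  rw [InP] at hP
  have hr := h.triple_le r rᵃ rᵃ rᵃ
  have resolvesZ (hW : f r u y + dist zᵃ r ≤ f u y zᵃ) : DominatesAt Δ r f v := by
    refine .of_pairs hΔ h u y ?_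
    have h1 := h.triple_le u z rᵃ rᵃ
    simp only [dist_antip_left hΔ, dist_antip_right hΔ, dist_self, dist_comm] at *
    linarith
  have resolvesU (hW : f r y zᵃ + dist u r ≤ f u y zᵃ)
      (hB : dist r zᵃ + dist zᵃ u = dist r u) : DominatesAt Δ r f v := by
    refine resolvesZ ?_
    have h1 := h.le_add_dist u zᵃ y
    simp only [dist_antip_left hΔ, dist_antip_right hΔ, dist_comm, h.comm] at *
    linarith
  rcases h.resolve u y zᵃ with hW | hW | hW
  rotate_left
  · refine resolvesZ ?_
    have h1 := h.le_add_dist y zᵃ u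
    simp only [dist_antip_left hΔ, dist_antip_right hΔ, dist_comm, h.comm] at *
    linarith
  · exact resolvesZ hW
  have resolvesUZ (hW2 : f r u rᵃ + dist z r ≤ f u z rᵃ) : DominatesAt Δ r f v := by
    refine .of_pairs hΔ h u y ?_
    have h1 := h.le_add_dist y zᵃ y
    have h2 := h.quad y u rᵃ
    have h3 := h.le_add_dist rᵃ y rᵃ
    simp only [dist_antip_left hΔ, dist_antip_right hΔ, dist_self, dist_comm, h.comm] at *
    linarith
  have leavesZ (hW2 : f r z rᵃ + dist u r ≤ f u z rᵃ) (hB : dist r z + dist z u = dist r u) :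
      DominatesAt Δ r f v := by
    refine resolvesUZ ?_
    have h1 := h.le_add_dist u z rᵃ
    simp only [dist_comm] at *
    linarith
  have between (hW2 : f r z rᵃ + dist u r ≤ f u z rᵃ)
      (hB : dist yᵃ u + dist u zᵃ = dist yᵃ zᵃ) : DominatesAt Δ r f v := by
    refine ⟨u, y, z, ?_, ?_⟩
    · simp only [InP, dist_antip_left hΔ, dist_antip_right hΔ, dist_comm] at *
      linarith
    have h1 := h.quad uᵃ z rᵃ
    have h2 := h.le_add_dist rᵃ uᵃ rᵃ
    simp only [dist_antip_left hΔ, dist_antip_right hΔ, dist_self, dist_comm, h.comm] at *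
    linarith
  have opposite (hW2 : f r z rᵃ + dist u r ≤ f u z rᵃ)
      (hB : dist u yᵃ + dist yᵃ zᵃ = dist u zᵃ)
      (hB' : dist r yᵃ + dist yᵃ u = dist r u) : DominatesAt Δ r f v := by
    refine ⟨zᵃ, u, y, ?_, ?_⟩
    · simp only [InP, dist_antip_left hΔ, dist_antip_right hΔ, dist_comm] at *
      linarith
    rw [antip_antip]
    have h1 := h.quad uᵃ zᵃ y
    have h2 := h.le_add_dist y uᵃ y
    have h3 := h.quad y z rᵃ
    have h4 := h.le_add_dist rᵃ y rᵃ
    simp only [dist_antip_left hΔ, dist_antip_right hΔ, dist_self, dist_comm, h.comm] at *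
    linarith
  have resolvesUU (hW2 : f r z rᵃ + dist u r ≤ f u z rᵃ) : DominatesAt Δ r f v := by
    have hr : dist yᵃ r + dist r zᵃ = dist yᵃ zᵃ := by
      simp only [dist_antip_left hΔ, dist_antip_right hΔ, dist_comm] at *
      linarith
    rcases mem_arc_or_leaves hΔ u hr with hB | hB | hB
    · exact between hW2 hB
    · rcases exists_aligned hΔ r u z zᵃ with (hC | hC) | (hC | hC) | (hC | hC)
      · refine opposite hW2 ?_ hB
        have h1 := dist_triangle u yᵃ zᵃ
        have h2 := dist_triangle yᵃ u z
        have h3 := dist_triangle r u zᵃ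
        have h4 := dist_triangle r yᵃ z
        simp only [dist_antip_left hΔ, dist_antip_right hΔ, dist_comm] at *
        linarith
      · exact leavesZ hW2 hC
      · refine leavesZ hW2 ?_
        have h1 := dist_triangle r z u
        have h2 := dist_triangle z r u
        simp only [dist_antip_left hΔ, dist_antip_right hΔ, dist_self, dist_comm] at *
        linarith
      · refine resolvesU hW ?_
        have h1 := dist_triangle r zᵃ u
        have h2 := dist_triangle zᵃ r u
        simp only [dist_antip_left hΔ, dist_antip_right hΔ, dist_self, dist_comm] at *
        linarith
      · refine between hW2 ?_
        have h1 := dist_triangle yᵃ u zᵃ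
        have h2 := dist_nonneg (x := r) (y := yᵃ)
        simp only [dist_antip_left hΔ, dist_antip_right hΔ, dist_comm] at *
        linarith
      · exact resolvesU hW hC
    · exact resolvesU hW hB
  rcases h.resolve u z rᵃ with hW2 | hW2 | hW2
  · exact resolvesUU hW2
  · exact resolvesUZ hW2
  · refine resolvesUU ?_
    have h1 := h.le_add_dist rᵃ u z
    simp only [dist_antip_left hΔ, dist_antip_right hΔ, dist_self, dist_comm, h.comm] at *
    linarith

theorem DominatesAt.of_resolve_left (hΔ : 0 < Δ) (h : IsWorkLike r f) (hP : InP Δ r y z)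
    (hv : f uᵃ uᵃ uᵃ + f u x yᵃ + f u y zᵃ + f u z xᵃ ≤ v)
    (hW : f r u yᵃ + dist x r ≤ f u x yᵃ) : DominatesAt Δ r f v := by
  refine .of_inP_request (u := u) hΔ h hP ?_
  have h1 := h.le_triple uᵃ
  have h2 := h.le_add_dist_third u z rᵃ xᵃ
  simp only [dist_antip_left hΔ, dist_antip_right hΔ, dist_comm] at *
  linarith

theorem DominatesAt.of_resolve_right (hΔ : 0 < Δ) (h : IsWorkLike r f) (hP : InP Δ x y rᵃ)
    (hv : f uᵃ uᵃ uᵃ + f u x yᵃ + f u y zᵃ + f u z xᵃ ≤ v)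
    (hW : f r u y + dist zᵃ r ≤ f u y zᵃ) : DominatesAt Δ r f v := by
  refine .of_resolve_left (u := u) (x := zᵃ) (y := yᵃ) (z := xᵃ) hΔ h ?_ ?_ ?_
  · simp only [InP, dist_antip_left hΔ, dist_antip_right hΔ, dist_comm] at *
    linarith
  · rw [antip_antip, antip_antip, antip_antip, h.swap_right u zᵃ y, h.swap_right u yᵃ x,
      h.swap_right u xᵃ z]
    linarith
  · rwa [antip_antip, h.swap_right u zᵃ y]

/-- The mixed case of `DominatesAt.of_mem_arc_antip`. -/
theorem DominatesAt.of_mem_arc_antip_of_resolve_left (hΔ : 0 < Δ) (h : IsWorkLike r f)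
    (hP : InP Δ x y z) (hr : dist r y + dist y z = dist r z)
    (hu : dist zᵃ u + dist u y = dist zᵃ y)
    (hv : f uᵃ uᵃ uᵃ + f u x yᵃ + f u y zᵃ + f u z xᵃ ≤ v)
    (hW1 : f r u yᵃ + dist x r ≤ f u x yᵃ) (hW2 : f r y zᵃ + dist u r ≤ f u y zᵃ)
    (hW3 : f r z xᵃ + dist u r ≤ f u z xᵃ) : DominatesAt Δ r f v := by
  rw [InP] at hP
  have h0 := h.le_triple uᵃ
  have hrr := h.triple_le r rᵃ rᵃ rᵃ
  have d1 := dist_triangle x r y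
  have h1 := h.le_add_dist z xᵃ z
  have h2 := h.le_add_dist rᵃ uᵃ rᵃ
  have h3 := h.le_add_dist rᵃ z uᵃ
  rcases h.exchange u yᵃ y zᵃ with he | he
  · refine ⟨yᵃ, z, u, ?_, ?_⟩
    · simp only [InP, dist_antip_left hΔ, dist_antip_right hΔ, dist_comm] at *
      linarith
    have h4 := h.quad uᵃ z z
    simp only [dist_antip_left hΔ, dist_antip_right hΔ, dist_self, dist_comm, h.comm,
      antip_antip] at *
    linarith
  · refine ⟨z, yᵃ, u, ?_, ?_⟩
    · simp only [InP, dist_antip_left hΔ, dist_antip_right hΔ, dist_comm] at *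
      linarith
    have h4 := h.quad uᵃ y yᵃ
    have h5 := h.quad z y uᵃ
    simp only [dist_antip_left hΔ, dist_antip_right hΔ, dist_self, dist_comm, h.comm,
      antip_antip] at *
    linarith

/-- The case of a request `r` on the arc from `zᵃ` to `y`. -/
theorem DominatesAt.of_mem_arc_antip (hΔ : 0 < Δ) (h : IsWorkLike r f) (hP : InP Δ x y z)
    (hr : dist r y + dist y z = dist r z)
    (hv : f uᵃ uᵃ uᵃ + f u x yᵃ + f u y zᵃ + f u z xᵃ ≤ v) : DominatesAt Δ r f v := by
  have h0 := h.le_triple uᵃ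
  have hrr := h.triple_le r rᵃ rᵃ rᵃ
  have hx : dist x r + dist r y = dist x y := by
    have h1 := dist_triangle x r y
    have h2 := dist_triangle r xᵃ z
    simp only [InP, dist_antip_left hΔ, dist_antip_right hΔ, dist_comm] at *
    linarith
  have branchY (hW : f r u zᵃ + dist y r ≤ f u y zᵃ) : DominatesAt Δ r f v := by
    refine .of_resolve_left (u := u) (x := y) (y := z) (z := x) hΔ h ?_ (by linarith) hW
    simp only [InP, dist_comm] at *
    linarith
  have branchZ (hW : f r u y + dist zᵃ r ≤ f u y zᵃ) : DominatesAt Δ r f v := by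
    refine .of_resolve_right (u := u) hΔ h ?_ hv hW
    simp only [InP, dist_antip_left hΔ, dist_antip_right hΔ, dist_comm] at *
    linarith
  rcases h.resolve u y zᵃ with hW2 | hW2 | hW2
  rotate_left
  · exact branchY hW2
  · exact branchZ hW2
  have hr' : dist zᵃ r + dist r y = dist zᵃ y := by
    simp only [dist_antip_left hΔ, dist_comm] at *
    linarith
  rcases mem_arc_or_leaves hΔ u hr' with hu | hu | hu
  rotate_left
  · refine branchZ ?_
    have h1 := h.le_add_dist u zᵃ y
    simp only [dist_antip_left hΔ, dist_antip_right hΔ, dist_comm, h.comm] at *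
    linarith
  · refine branchY ?_
    have h1 := h.le_add_dist u y zᵃ
    simp only [dist_comm] at *
    linarith
  have hW1 : f r x yᵃ + dist u r ≤ f u x yᵃ ∨ f r u yᵃ + dist x r ≤ f u x yᵃ := by
    rcases h.resolve u x yᵃ with hW | hW | hW
    · exact .inl hW
    · exact .inr hW
    · right
      have h1 := h.le_add_dist yᵃ x u
      simp only [dist_antip_left hΔ, dist_comm, h.comm] at *
      linarith
  have hW3 : f r z xᵃ + dist u r ≤ f u z xᵃ ∨ f r u z + dist xᵃ r ≤ f u z xᵃ := by
    rcases h.resolve u z xᵃ with hW | hW | hW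
    · exact .inl hW
    · right
      have h1 := h.le_add_dist z xᵃ u
      simp only [InP, dist_antip_left hΔ, dist_antip_right hΔ, dist_comm, h.comm] at *
      linarith
    · exact .inr hW
  rcases hW1 with hW1 | hW1 <;> rcases hW3 with hW3 | hW3
  · refine ⟨x, y, z, hP, ?_⟩
    have h1 := h.triple_le uᵃ uᵃ uᵃ rᵃ
    simp only [dist_antip_left hΔ, dist_antip_right hΔ, dist_comm] at *
    linarith
  · refine .of_mem_arc_antip_of_resolve_left (u := u) (x := xᵃ) (y := zᵃ) (z := yᵃ)
      hΔ h ?_ ?_ ?_ ?_ ?_ ?_ ?_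
    · simp only [InP, dist_antip_left hΔ, dist_antip_right hΔ, dist_comm] at *
      linarith
    · simp only [dist_antip_left hΔ, dist_antip_right hΔ, dist_comm] at *
      linarith
    · rw [antip_antip, dist_comm y u, add_comm, dist_comm u zᵃ, dist_comm y]
      exact hu
    · rw [antip_antip, antip_antip, antip_antip, h.swap_right u xᵃ z, h.swap_right u zᵃ y,
        h.swap_right u yᵃ x]
      linarith
    · rwa [antip_antip, h.swap_right u xᵃ z]
    · rwa [antip_antip, h.swap_right u zᵃ y, h.comm zᵃ y]
    · rwa [antip_antip, h.swap_right u yᵃ x, h.comm yᵃ x]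
  · exact .of_mem_arc_antip_of_resolve_left hΔ h hP hr hu hv hW1 hW2 hW3
  rcases h.exchange u z y zᵃ with he | he
  · refine .of_pairs hΔ h u y ?_
    have h1 := h.le_add_dist rᵃ z rᵃ
    have h2 := h.le_add_dist rᵃ zᵃ z
    simp only [dist_antip_left hΔ, dist_antip_right hΔ, dist_self, dist_comm, h.comm] at *
    linarith
  · refine ⟨z, yᵃ, u, ?_, ?_⟩
    · simp only [InP, dist_antip_left hΔ, dist_antip_right hΔ, dist_comm] at *
      linarith
    have h1 := h.quad uᵃ u yᵃ
    have h2 := h.le_add_dist rᵃ u rᵃ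
    have h3 := h.le_add_dist rᵃ uᵃ u
    simp only [dist_antip_left hΔ, dist_antip_right hΔ, dist_self, dist_comm, h.comm,
      antip_antip] at *
    linarith

/-- The main case of `DominatesAt.of_mem_arc`. -/
theorem DominatesAt.of_mem_arc_of_resolve_middle (hΔ : 0 < Δ) (h : IsWorkLike r f)
    (hP : InP Δ x y z) (hr : dist r x + dist x z = dist r z)
    (hu : dist x u + dist u zᵃ = dist x zᵃ)
    (hv : f uᵃ uᵃ uᵃ + f u x yᵃ + f u y zᵃ + f u z xᵃ ≤ v)
    (hW1 : f r x yᵃ + dist u r ≤ f u x yᵃ) (hW2 : f r y zᵃ + dist u r ≤ f u y zᵃ)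
    (hW3 : f r u xᵃ + dist z r ≤ f u z xᵃ) : DominatesAt Δ r f v := by
  have h0 := h.le_triple uᵃ
  have hrr := h.triple_le r rᵃ rᵃ rᵃ
  have d1 := dist_triangle x u y
  have d2 := dist_triangle y zᵃ u
  have d3 := dist_triangle x r y
  have d4 := dist_triangle y zᵃ r
  refine ⟨x, y, uᵃ, ?_, ?_⟩
  · simp only [InP, dist_antip_left hΔ, dist_antip_right hΔ, dist_comm] at *
    linarith
  have h1 := h.le_add_dist y zᵃ y
  have h2 := h.quad y u xᵃ
  have h3 := h.quad uᵃ y xᵃ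
  have h4 := h.le_add_dist rᵃ uᵃ rᵃ
  have h5 := h.le_add_dist rᵃ y uᵃ
  simp only [InP, dist_antip_left hΔ, dist_antip_right hΔ, dist_self, dist_comm, h.comm,
    antip_antip] at *
  linarith

/-- The case of a request `r` on the arc from `x` to `zᵃ`. -/
theorem DominatesAt.of_mem_arc (hΔ : 0 < Δ) (h : IsWorkLike r f) (hP : InP Δ x y z)
    (hr : dist r x + dist x z = dist r z)
    (hv : f uᵃ uᵃ uᵃ + f u x yᵃ + f u y zᵃ + f u z xᵃ ≤ v) : DominatesAt Δ r f v := by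
  have d1 := dist_triangle x r y
  have d2 := dist_triangle y zᵃ r
  have hr' : dist x r + dist r zᵃ = dist x zᵃ := by
    simp only [dist_antip_right hΔ, dist_comm] at *
    linarith
  have branchX (hW : f r u yᵃ + dist x r ≤ f u x yᵃ) : DominatesAt Δ r f v := by
    refine .of_resolve_left (u := u) hΔ h ?_ hv hW
    simp only [InP, dist_antip_left hΔ, dist_antip_right hΔ, dist_comm] at *
    linarith
  have branchZ (hW : f r u y + dist zᵃ r ≤ f u y zᵃ) : DominatesAt Δ r f v := by
    refine .of_resolve_right (u := u) hΔ h ?_ hv hW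
    simp only [InP, dist_antip_left hΔ, dist_antip_right hΔ, dist_comm] at *
    linarith
  rcases h.resolve u x yᵃ with hW1 | hW1 | hW1
  rotate_left
  · exact branchX hW1
  · refine branchX ?_
    have h1 := h.le_add_dist yᵃ x u
    simp only [InP, dist_antip_left hΔ, dist_antip_right hΔ, dist_comm, h.comm] at *
    linarith
  rcases h.resolve u y zᵃ with hW2 | hW2 | hW2
  rotate_left
  · refine branchZ ?_
    have h1 := h.le_add_dist y zᵃ u
    simp only [InP, dist_antip_left hΔ, dist_antip_right hΔ, dist_comm, h.comm] at *
    linarith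
  · exact branchZ hW2
  rcases mem_arc_or_leaves hΔ u hr' with hu | hu | hu
  rotate_left
  · refine branchX ?_
    have h1 := h.le_add_dist u x yᵃ
    simp only [dist_comm] at *
    linarith
  · refine branchZ ?_
    have h1 := h.le_add_dist u zᵃ y
    simp only [dist_antip_left hΔ, dist_antip_right hΔ, dist_comm, h.comm] at *
    linarith
  rcases h.resolve u z xᵃ with hW3 | hW3 | hW3
  · refine ⟨x, y, z, hP, ?_⟩
    have h1 := h.triple_le uᵃ uᵃ uᵃ rᵃ
    simp only [dist_antip_left hΔ, dist_antip_right hΔ, dist_comm] at *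
    linarith
  · exact .of_mem_arc_of_resolve_middle hΔ h hP hr hu hv hW1 hW2 hW3
  · refine .of_mem_arc_of_resolve_middle (u := u) (x := zᵃ) (y := yᵃ) (z := xᵃ)
      hΔ h ?_ ?_ ?_ ?_ ?_ ?_ ?_
    · simp only [InP, dist_antip_left hΔ, dist_antip_right hΔ, dist_comm] at *
      linarith
    · simp only [dist_antip_left hΔ, dist_antip_right hΔ, dist_comm] at *
      linarith
    · rw [antip_antip, dist_comm u x, add_comm, dist_comm zᵃ u, dist_comm zᵃ x]
      exact hu
    · rw [antip_antip, antip_antip, antip_antip, h.swap_right u zᵃ y, h.swap_right u yᵃ x,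
        h.swap_right u xᵃ z]
      linarith
    · rwa [antip_antip, h.swap_right u zᵃ y, h.comm zᵃ y]
    · rwa [antip_antip, h.swap_right u yᵃ x, h.comm yᵃ x]
    · rwa [antip_antip, h.swap_right u xᵃ z]

theorem dominatesAt_of_inP (hΔ : 0 < Δ) (h : IsWorkLike r f) (hP : InP Δ x y z) :
    DominatesAt Δ r f (f uᵃ uᵃ uᵃ + f u x yᵃ + f u y zᵃ + f u z xᵃ) := by
  have hP1 : InP Δ y z x := by rw [InP] at *; linarith
  have hP2 : InP Δ z x y := by rw [InP] at *; linarith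
  rcases exists_aligned hΔ r x y z with (hB | hB) | (hB | hB) | (hB | hB)
  · exact .of_mem_arc_antip (u := u) hΔ h hP2 hB (by linarith)
  · exact .of_mem_arc (u := u) hΔ h hP1 hB (by linarith)
  · exact .of_mem_arc_antip (u := u) hΔ h hP hB le_rfl
  · exact .of_mem_arc (u := u) hΔ h hP2 hB (by linarith)
  · exact .of_mem_arc (u := u) hΔ h hP hB le_rfl
  · exact .of_mem_arc_antip (u := u) hΔ h hP1 hB (by linarith)
end Circle

section WorkFnThree

theorem update_vecThree {α : Type*} (a b c p : α) :
    Function.update ![a, b, c] 0 p = ![p, b, c] ∧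
    Function.update ![a, b, c] 1 p = ![a, p, c] ∧
    Function.update ![a, b, c] 2 p = ![a, b, p] := by
  refine ⟨?_, ?_, ?_⟩ <;> ext i <;> fin_cases i <;> rfl

variable {Ω : Type*} [MetricSpace Ω] (X₀ : Fin 3 → Ω) (r : ℕ → Ω) (t : ℕ)

theorem workFn_swap_left (a b c : Ω) :
    workFn 3 X₀ r t ![a, b, c] = workFn 3 X₀ r t ![b, a, c] := by
  rw [← workFn_comp_perm X₀ r t ![a, b, c] (Equiv.swap 0 1)]
  congr 1
  ext i
  fin_cases i <;> rfl

theorem workFn_swap_right (a b c : Ω) :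
    workFn 3 X₀ r t ![a, b, c] = workFn 3 X₀ r t ![a, c, b] := by
  rw [← workFn_comp_perm X₀ r t ![a, b, c] (Equiv.swap 1 2)]
  congr 1
  ext i
  fin_cases i <;> rfl

theorem workFn_le_add_dist (a a' b c : Ω) :
    workFn 3 X₀ r t ![a, b, c] ≤ workFn 3 X₀ r t ![a', b, c] + dist a a' := by
  have h1 := workFn_le_add_confDist X₀ r t ![a, b, c] ![a', b, c]
  have h2 := confDist_update_le ![a, b, c] 0 a'
  rw [(update_vecThree a b c a').1] at h2
  exact h1.trans (by simpa using h2)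

theorem workFn_update_request_le (X : Fin 3 → Ω) (i : Fin 3) :
    workFn 3 X₀ r (t + 1) (Function.update X i (r (t + 1))) ≤
      workFn 3 X₀ r t (Function.update X i (r (t + 1))) := by
  simpa using workFn_succ_le_update X₀ r t (Function.update X i (r (t + 1))) i

theorem workFn_resolve (a b c : Ω) :
    workFn 3 X₀ r (t + 1) ![r (t + 1), b, c] + dist a (r (t + 1)) ≤
        workFn 3 X₀ r (t + 1) ![a, b, c] ∨
      workFn 3 X₀ r (t + 1) ![r (t + 1), a, c] + dist b (r (t + 1)) ≤
        workFn 3 X₀ r (t + 1) ![a, b, c] ∨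
      workFn 3 X₀ r (t + 1) ![r (t + 1), a, b] + dist c (r (t + 1)) ≤
        workFn 3 X₀ r (t + 1) ![a, b, c] := by
  obtain ⟨i, hi⟩ := exists_workFn_update_add_dist_le X₀ r t ![a, b, c]
  have h := workFn_update_request_le X₀ r t ![a, b, c] i
  obtain ⟨e0, e1, e2⟩ := update_vecThree a b c (r (t + 1))
  have hi' := (add_le_add_left h (dist (![a, b, c] i) (r (t + 1)))).trans hi
  fin_cases i
  · left
    simpa [e0] using hi'
  · right; left
    rw [workFn_swap_left]
    simpa [e1] using hi'
  · right; right
    rw [workFn_swap_left, workFn_swap_right]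
    simpa [e2] using hi'

theorem workFn_exchange (p a b c d : Ω) :
    workFn 3 X₀ r t ![p, a, c] + workFn 3 X₀ r t ![p, b, d] ≤
        workFn 3 X₀ r t ![p, a, b] + workFn 3 X₀ r t ![p, c, d] ∨
      workFn 3 X₀ r t ![p, a, d] + workFn 3 X₀ r t ![p, b, c] ≤
        workFn 3 X₀ r t ![p, a, b] + workFn 3 X₀ r t ![p, c, d] := by
  have e (j : Fin 3) (Y X : Fin 3 → Ω) :
      ({j} : Finset (Fin 3)).piecewise Y X = Function.update X j (Y j) :=
    Finset.piecewise_singleton _ _ _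
  obtain ⟨σ, hσ⟩ := workFn_quasiconvex X₀ r t ![p, a, b] ![p, c, d]
  have hY : ![p, c, d] ∘ σ = ![![p, c, d] (σ 0), ![p, c, d] (σ 1), ![p, c, d] (σ 2)] := by
    ext i
    fin_cases i <;> rfl
  have h1 := hσ {1}
  have h2 := hσ {2}
  have i01 : σ 0 ≠ σ 1 := σ.injective.ne (by decide)
  have i02 : σ 0 ≠ σ 2 := σ.injective.ne (by decide)
  have i12 : σ 1 ≠ σ 2 := σ.injective.ne (by decide)
  rw [e, e, hY, (update_vecThree _ _ _ _).2.1, (update_vecThree _ _ _ _).2.1] at h1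
  rw [e, e, hY, (update_vecThree _ _ _ _).2.2, (update_vecThree _ _ _ _).2.2] at h2
  generalize σ 0 = s0 at *
  generalize σ 1 = s1 at *
  generalize σ 2 = s2 at *
  have l := workFn_swap_left X₀ r t
  have m := workFn_swap_right X₀ r t
  fin_cases s0 <;> fin_cases s1 <;> fin_cases s2 <;> simp at i01 i02 i12 h1 h2
  all_goals first
    | left; linarith [l d p b, m p d b, m c a p, l c p a, m p c a]
    | right; linarith [l c p b, m p c b, m d a p, l d p a, m p d a]

theorem isWorkLike_workFn :
    IsWorkLike (r (t + 1)) fun a b c => workFn 3 X₀ r (t + 1) ![a, b, c] where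
  swap_left := workFn_swap_left X₀ r (t + 1)
  swap_right := workFn_swap_right X₀ r (t + 1)
  lipschitz := workFn_le_add_dist X₀ r (t + 1)
  resolve := workFn_resolve X₀ r t
  exchange := workFn_exchange X₀ r (t + 1) (r (t + 1))

end WorkFnThree

/-- For the work function `w_t` of a `3`-server instance on the circle with last request
`r = r_t`: for every `u` and `(x,y,z) ∈ P` there is `(x',y',z') ∈ P` with
`Φ*(w_t,u,x,y,z) ≥ Φ*(w_t,r,x',y',z')`; consequently the minimum of `Φ*` over all `u`
and `(x,y,z) ∈ P` equals the minimum with `u` restricted to `r_t`. -/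
theorem phiStar_minimized_at_request (Δ : ℝ) (hΔ : 0 < Δ)
    (X₀ : Fin 3 → AddCircle (2*Δ)) (r : ℕ → AddCircle (2*Δ)) (T t : ℕ)
    (ht : 1 ≤ t) (htT : t ≤ T) :
    (∀ u x y z : AddCircle (2*Δ), InP Δ x y z →
      ∃ x' y' z' : AddCircle (2*Δ), InP Δ x' y' z' ∧
        PhiStar Δ (workFn 3 X₀ r t) (r t) x' y' z' ≤
          PhiStar Δ (workFn 3 X₀ r t) u x y z) ∧
    sInf {v : ℝ | ∃ u x y z : AddCircle (2*Δ), InP Δ x y z ∧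
        v = PhiStar Δ (workFn 3 X₀ r t) u x y z} =
      sInf {v : ℝ | ∃ x y z : AddCircle (2*Δ), InP Δ x y z ∧
        v = PhiStar Δ (workFn 3 X₀ r t) (r t) x y z} := by
  obtain ⟨s, rfl⟩ := Nat.exists_eq_add_of_le' ht
  have hmain (u x y z : AddCircle (2*Δ)) (hP : InP Δ x y z) :
      ∃ x' y' z' : AddCircle (2*Δ), InP Δ x' y' z' ∧
        PhiStar Δ (workFn 3 X₀ r (s + 1)) (r (s + 1)) x' y' z' ≤
          PhiStar Δ (workFn 3 X₀ r (s + 1)) u x y z :=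
    dominatesAt_of_inP hΔ (isWorkLike_workFn X₀ r s) hP
  have hbdd : BddBelow {v : ℝ | ∃ u x y z : AddCircle (2*Δ), InP Δ x y z ∧
      v = PhiStar Δ (workFn 3 X₀ r (s + 1)) u x y z} := by
    refine ⟨0, ?_⟩
    rintro _ ⟨u, x, y, z, -, rfl⟩
    have := workFn_nonneg X₀ r (s + 1)
    exact add_nonneg (add_nonneg (add_nonneg (this _) (this _)) (this _)) (this _)
  have hsub : {v : ℝ | ∃ x y z : AddCircle (2*Δ), InP Δ x y z ∧
      v = PhiStar Δ (workFn 3 X₀ r (s + 1)) (r (s + 1)) x y z} ⊆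
      {v : ℝ | ∃ u x y z : AddCircle (2*Δ), InP Δ x y z ∧
        v = PhiStar Δ (workFn 3 X₀ r (s + 1)) u x y z} := by
    rintro _ ⟨x, y, z, hP, rfl⟩
    exact ⟨_, x, y, z, hP, rfl⟩
  have hne : {v : ℝ | ∃ x y z : AddCircle (2*Δ), InP Δ x y z ∧
      v = PhiStar Δ (workFn 3 X₀ r (s + 1)) (r (s + 1)) x y z}.Nonempty :=
    ⟨_, 0, 0, _, inP_antip hΔ 0 0, rfl⟩
  refine ⟨hmain, le_antisymm (csInf_le_csInf hbdd hne hsub) ?_⟩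
  refine le_csInf (hne.mono hsub) ?_
  rintro _ ⟨u, x, y, z, hP, rfl⟩
  obtain ⟨x', y', z', hP', hle⟩ := hmain u x y z hP
  exact (csInf_le (hbdd.mono hsub) ⟨x', y', z', hP', rfl⟩).trans hle
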